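/- Let f ∈ 𝒦 have radius of convergence R > 0, Khinchin family (X_t) and fulcrum F. For any integer n ≥ 3: limsup_{s↑ln R} |F^{(j)}(s)|/F″(s)^{j/2} < +∞ for every 3 ≤ j ≤ n if and only if limsup_{t↑R} |E(X̆_t^k)| < +∞ for every 3 ≤ k ≤ n. -/

import Mathlib

open scoped BigOperators Topology
open Filter

namespace KhinchinPaper

/-- Sum of the power series with coefficients `a` at `t`. -/
noncomputable def fsum (a : ℕ → ℝ) (t : ℝ) : ℝ := ∑' n : ℕ, a n * t ^ n

/-- The class `𝒦`: non-constant power series with non-negative coefficients, `a 0 > 0`,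
and radius of convergence `R > 0`. -/
structure IsK (a : ℕ → ℝ) (R : ℝ) : Prop where
  pos₀ : 0 < a 0
  nonneg : ∀ n, 0 ≤ a n
  nonconst : ∃ n, 0 < n ∧ 0 < a n
  Rpos : 0 < R
  conv : ∀ t : ℝ, 0 ≤ t → t < R → Summable fun n : ℕ => a n * t ^ n
  radius : ∀ t : ℝ, R < t → ¬ Summable fun n : ℕ => a n * t ^ n

/-- Mean function `m_f(t) = t f'(t)/f(t)`. -/
noncomputable def mf (a : ℕ → ℝ) (t : ℝ) : ℝ :=
  (∑' n : ℕ, (n : ℝ) * a n * t ^ n) / fsum a t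

/-- Variance function `σ_f²(t)`. -/
noncomputable def sigma2 (a : ℕ → ℝ) (t : ℝ) : ℝ :=
  (∑' n : ℕ, (n : ℝ) ^ 2 * a n * t ^ n) / fsum a t - (mf a t) ^ 2

noncomputable def sigma (a : ℕ → ℝ) (t : ℝ) : ℝ := Real.sqrt (sigma2 a t)

/-- `k`-th moment of the normalized Khinchin family variable `X̆_t`. -/
noncomputable def normMoment (a : ℕ → ℝ) (t : ℝ) (k : ℕ) : ℝ :=
  ∑' n : ℕ, (a n * t ^ n / fsum a t) * (((n : ℝ) - mf a t) / sigma a t) ^ k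

/-- `k`-th central moment of `X_t`. -/
noncomputable def centralMoment (a : ℕ → ℝ) (t : ℝ) (k : ℕ) : ℝ :=
  ∑' n : ℕ, (a n * t ^ n / fsum a t) * ((n : ℝ) - mf a t) ^ k

/-- Characteristic function `E(e^{iθ X̆_t})` of the normalized variable. -/
noncomputable def charfun (a : ℕ → ℝ) (t θ : ℝ) : ℂ :=
  ∑' n : ℕ, ((a n * t ^ n / fsum a t : ℝ) : ℂ) *
    Complex.exp (Complex.I * (θ : ℂ) * ((((n : ℝ) - mf a t) / sigma a t : ℝ) : ℂ))

/-- `f` is Gaussian: `X̆_t → N(0,1)` in distribution as `t ↑ R`, expressed via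
pointwise convergence of characteristic functions (Lévy's continuity theorem). -/
def IsGaussian (a : ℕ → ℝ) (R : ℝ) : Prop :=
  ∀ θ : ℝ, Tendsto (fun t => charfun a t θ) (𝓝[<] R)
    (𝓝 (Complex.exp (-(θ : ℂ) ^ 2 / 2)))

/-- Gaussian for entire `f` (radius `R = ∞`, so `t → +∞`). -/
def IsGaussianEntire (a : ℕ → ℝ) : Prop :=
  ∀ θ : ℝ, Tendsto (fun t => charfun a t θ) atTop
    (𝓝 (Complex.exp (-(θ : ℂ) ^ 2 / 2)))

/-- The fulcrum `F(s) = log f(e^s)` restricted to the real axis. -/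
noncomputable def fulcrum (a : ℕ → ℝ) (s : ℝ) : ℝ := Real.log (fsum a (Real.exp s))

/-- The quotient `F^{(j)}(s) / F''(s)^{j/2}`. -/
noncomputable def Fq (a : ℕ → ℝ) (j : ℕ) (s : ℝ) : ℝ :=
  iteratedDeriv j (fulcrum a) s / (iteratedDeriv 2 (fulcrum a) s) ^ ((j : ℝ) / 2)

/-- Tuples `(m₂, …, m_n)` of non-negative integers with `2m₂ + ⋯ + n m_n = n`,
padded with `m₀ = m₁ = 0` and encoded as functions on `Fin (n+1)`. -/
def tuples (n : ℕ) : Finset (Fin (n + 1) → ℕ) :=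
  (Fintype.piFinset fun _ : Fin (n + 1) => Finset.range (n + 1)).filter
    fun m => m 0 = 0 ∧ m 1 = 0 ∧ ∑ j : Fin (n + 1), (j : ℕ) * m j = n

/-- Integer moments of a standard normal random variable `Z`. -/
noncomputable def gaussMoment (k : ℕ) : ℝ :=
  if Even k then (Nat.factorial k : ℝ) / ((Nat.factorial (k / 2) : ℝ) * 2 ^ (k / 2)) else 0

/-- The complex power series sum. -/
noncomputable def fsumC (a : ℕ → ℝ) (z : ℂ) : ℂ := ∑' n : ℕ, (a n : ℂ) * z ^ n

/-- The complex fulcrum `F(z) = log f(e^z)`. -/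
noncomputable def fulcrumC (a : ℕ → ℝ) (z : ℂ) : ℂ := Complex.log (fsumC a (Complex.exp z))

end KhinchinPaper

namespace KhinchinPaper

open MeasureTheory ProbabilityTheory Asymptotics

section Recursion

/-- Leibniz's rule applied to `G' = (log G)' * G`. -/
lemma iteratedDeriv_succ_eq_sum_log {G : ℝ → ℝ} {x : ℝ} (hG : AnalyticAt ℝ G x) (hx : 0 < G x)
    (n : ℕ) :
    iteratedDeriv (n + 1) G x = ∑ i ∈ Finset.range (n + 1),
      n.choose i * iteratedDeriv (i + 1) (fun u => Real.log (G u)) x *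
        iteratedDeriv (n - i) G x := by
  have hL : AnalyticAt ℝ (fun u => Real.log (G u)) x := hG.log hx
  have hev : deriv G =ᶠ[𝓝 x] deriv (fun u => Real.log (G u)) * G := by
    filter_upwards [hG.eventually_analyticAt, hG.continuousAt.eventually (lt_mem_nhds hx)]
      with u hu hpos
    rw [Pi.mul_apply, deriv.log hu.differentiableAt hpos.ne', div_mul_cancel₀ _ hpos.ne']
  rw [iteratedDeriv_succ', hev.iteratedDeriv_eq,
    iteratedDeriv_mul hL.deriv.contDiffAt hG.contDiffAt]
  simp only [iteratedDeriv_succ']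

/-- If `M` and `κ` satisfy the moment-cumulant recursion with vanishing first cumulant, then the
moments `M k`, `3 ≤ k ≤ n`, are bounded iff the cumulants `κ j`, `3 ≤ j ≤ n`, are. -/
lemma isBigO_one_cumulant_iff_moment {ι : Type*} {l : Filter ι} {M κ : ℕ → ι → ℝ}
    (h0 : M 0 =ᶠ[l] 1) (h1 : M 1 =O[l] (1 : ι → ℝ)) (hκ : κ 2 =O[l] (1 : ι → ℝ))
    (hrec : ∀ n, M (n + 1) =ᶠ[l] fun x => ∑ i ∈ Finset.range n,
      (n.choose (i + 1) : ℝ) * κ (i + 2) x * M (n - 1 - i) x) (n : ℕ) :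
    (∀ j, 3 ≤ j → j ≤ n → κ j =O[l] (1 : ι → ℝ)) ↔
      ∀ k, 3 ≤ k → k ≤ n → M k =O[l] (1 : ι → ℝ) := by
  have hprod : ∀ {c : ℝ} {f g : ι → ℝ}, f =O[l] (1 : ι → ℝ) → g =O[l] (1 : ι → ℝ) →
      (fun x => c * f x * g x) =O[l] (1 : ι → ℝ) := fun {c f g} hf hg => by
    refine ((hf.const_mul_left c).mul hg).trans (IsBigO.of_bound 1 ?_)
    simp
  have hM0 : M 0 =O[l] (1 : ι → ℝ) := h0.trans_isBigO (isBigO_refl _ _)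
  have hM2 : M 2 =O[l] (1 : ι → ℝ) := by
    refine (hrec 1).trans_isBigO (IsBigO.fun_sum fun i hi => ?_)
    obtain rfl : i = 0 := by simpa using hi
    exact hprod hκ hM0
  constructor
  · intro hκn
    have key : ∀ k, k ≤ n → M k =O[l] (1 : ι → ℝ) := by
      intro k
      induction k using Nat.strong_induction_on with
      | _ k ih =>
        intro hk
        match k with
        | 0 => exact hM0
        | 1 => exact h1
        | k + 2 =>
          refine (hrec (k + 1)).trans_isBigO (IsBigO.fun_sum fun i hi => ?_)
          rw [Finset.mem_range] at hi
          refine hprod ?_ (ih _ (by omega) (by omega))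
          rcases Nat.eq_zero_or_pos i with rfl | hi0
          · exact hκ
          · exact hκn _ (by omega) (by omega)
    exact fun k _ hk => key k hk
  · intro hMn
    have hM : ∀ k, k ≤ n → M k =O[l] (1 : ι → ℝ) := by
      intro k hk
      match k with
      | 0 => exact hM0
      | 1 => exact h1
      | 2 => exact hM2
      | k + 3 => exact hMn _ (by omega) hk
    have key : ∀ j, j + 2 ≤ n → κ (j + 2) =O[l] (1 : ι → ℝ) := by
      intro j
      induction j using Nat.strong_induction_on with
      | _ j ih =>
        intro hj
        have heq : κ (j + 2) =ᶠ[l] fun x => M (j + 2) x - ∑ i ∈ Finset.range j,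
            ((j + 1).choose (i + 1) : ℝ) * κ (i + 2) x * M (j + 1 - 1 - i) x := by
          filter_upwards [hrec (j + 1), h0] with x hx hx0
          rw [hx, Finset.sum_range_succ]
          simp [hx0]
        refine heq.trans_isBigO ((hM _ hj).sub (IsBigO.fun_sum fun i hi => ?_))
        rw [Finset.mem_range] at hi
        exact hprod (ih i hi (by omega)) (hM _ (by omega))
    intro j hj3 hjn
    obtain ⟨j, rfl⟩ := Nat.exists_eq_add_of_le' (show 2 ≤ j by omega)
    exact key j hjn

end Recursion

section Measure

/-- The measure on `ℕ` whose mass at `n` is `a n`. -/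
noncomputable def coeffMeasure (a : ℕ → ℝ) : Measure ℕ :=
  Measure.sum fun n => ENNReal.ofReal (a n) • Measure.dirac n

lemma integrable_coeffMeasure_iff {a : ℕ → ℝ} (ha : ∀ n, 0 ≤ a n) {g : ℕ → ℝ} :
    Integrable g (coeffMeasure a) ↔ Summable fun n => a n * ‖g n‖ := by
  simp [coeffMeasure, integrable_sum_dirac_iff, ENNReal.toReal_ofReal (ha _)]

lemma integral_coeffMeasure {a : ℕ → ℝ} (ha : ∀ n, 0 ≤ a n) (g : ℕ → ℝ) :
    ∫ n, g n ∂coeffMeasure a = ∑' n, a n * g n := by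
  simp [coeffMeasure, integral_sum_dirac, ENNReal.toReal_ofReal (ha _)]

variable {a : ℕ → ℝ} {R s : ℝ}

lemma mul_exp_mul_sub (c m : ℝ) (n : ℕ) :
    c * Real.exp (s * (n - m)) = Real.exp (-(s * m)) * (c * Real.exp s ^ n) := by
  rw [← Real.exp_nat_mul, mul_left_comm, ← Real.exp_add]
  ring_nf

lemma IsK.mem_interior_integrableExpSet (hK : IsK a R) (m : ℝ) (hs : s < Real.log R) :
    s ∈ interior (integrableExpSet (fun n : ℕ => (n : ℝ) - m) (coeffMeasure a)) := by
  refine mem_interior.2 ⟨Set.Iio (Real.log R), fun u hu => ?_, isOpen_Iio, hs⟩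
  refine (integrable_coeffMeasure_iff hK.nonneg).2 ?_
  simp only [Real.norm_eq_abs, Real.abs_exp, mul_exp_mul_sub]
  exact (hK.conv _ (Real.exp_pos u).le ((Real.lt_log_iff_exp_lt hK.Rpos).1 hu)).mul_left _

lemma mgf_coeffMeasure (ha : ∀ n, 0 ≤ a n) (m s : ℝ) :
    mgf (fun n : ℕ => (n : ℝ) - m) (coeffMeasure a) s =
      Real.exp (-(s * m)) * fsum a (Real.exp s) := by
  simp only [mgf, integral_coeffMeasure ha, mul_exp_mul_sub, tsum_mul_left, fsum]

lemma IsK.fsum_pos (hK : IsK a R) {t : ℝ} (ht : 0 ≤ t) (htR : t < R) : 0 < fsum a t :=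
  (hK.conv t ht htR).tsum_pos (fun n => mul_nonneg (hK.nonneg n) (pow_nonneg ht n)) 0
    (by simpa using hK.pos₀)

lemma IsK.summable_pow_mul (hK : IsK a R) (m : ℝ) (hs : s < Real.log R) (k : ℕ) :
    Summable fun n : ℕ => ((n : ℝ) - m) ^ k * (a n * Real.exp s ^ n) := by
  have h := (integrable_coeffMeasure_iff hK.nonneg).1
    (integrable_pow_mul_exp_of_mem_interior_integrableExpSet
      (hK.mem_interior_integrableExpSet m hs) k)
  have h' : Summable fun n : ℕ =>
      a n * (((n : ℝ) - m) ^ k * Real.exp (s * (n - m))) := by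
    refine Summable.of_norm (h.congr fun n => ?_)
    rw [norm_mul (a n), Real.norm_of_nonneg (hK.nonneg n)]
  refine (h'.mul_left (Real.exp (s * m))).congr fun n => ?_
  rw [mul_left_comm (a n), mul_exp_mul_sub, Real.exp_neg]
  field_simp

lemma IsK.iteratedDeriv_mgf_coeffMeasure (hK : IsK a R) (hs : s < Real.log R) (k : ℕ) :
    iteratedDeriv k (mgf (fun n : ℕ => (n : ℝ) - mf a (Real.exp s)) (coeffMeasure a)) s =
      Real.exp (-(s * mf a (Real.exp s))) * fsum a (Real.exp s) *
        centralMoment a (Real.exp s) k := by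
  have hf := (hK.fsum_pos (Real.exp_pos s).le ((Real.lt_log_iff_exp_lt hK.Rpos).1 hs)).ne'
  rw [iteratedDeriv_mgf (hK.mem_interior_integrableExpSet _ hs),
    integral_coeffMeasure hK.nonneg, centralMoment, ← tsum_mul_left]
  refine tsum_congr fun n => ?_
  rw [mul_left_comm (a n), mul_exp_mul_sub]
  field_simp

lemma IsK.centralMoment_zero (hK : IsK a R) (hs : s < Real.log R) :
    centralMoment a (Real.exp s) 0 = 1 := by
  have hf := (hK.fsum_pos (Real.exp_pos s).le ((Real.lt_log_iff_exp_lt hK.Rpos).1 hs)).ne'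
  simp only [centralMoment, pow_zero, mul_one, tsum_div_const]
  exact div_self hf

lemma IsK.centralMoment_one (hK : IsK a R) (hs : s < Real.log R) :
    centralMoment a (Real.exp s) 1 = 0 := by
  have hf := (hK.fsum_pos (Real.exp_pos s).le ((Real.lt_log_iff_exp_lt hK.Rpos).1 hs)).ne'
  have h0 : Summable fun n : ℕ => a n * Real.exp s ^ n := by
    simpa using hK.summable_pow_mul 0 hs 0
  have h1 : Summable fun n : ℕ => (n : ℝ) * a n * Real.exp s ^ n := by
    simpa [mul_assoc] using hK.summable_pow_mul 0 hs 1
  have h : ∀ n : ℕ, a n * Real.exp s ^ n / fsum a (Real.exp s) *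
      ((n : ℝ) - mf a (Real.exp s)) ^ 1 = (n : ℝ) * a n * Real.exp s ^ n / fsum a (Real.exp s) -
        mf a (Real.exp s) / fsum a (Real.exp s) * (a n * Real.exp s ^ n) := fun n => by ring
  rw [centralMoment, tsum_congr h, (h1.div_const _).tsum_sub (h0.mul_left _), tsum_div_const,
    tsum_mul_left]
  change mf a (Real.exp s) - _ * fsum a (Real.exp s) = 0
  field_simp
  ring

lemma IsK.centralMoment_two (hK : IsK a R) (hs : s < Real.log R) :
    centralMoment a (Real.exp s) 2 = sigma2 a (Real.exp s) := by
  have hf := (hK.fsum_pos (Real.exp_pos s).le ((Real.lt_log_iff_exp_lt hK.Rpos).1 hs)).ne'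
  have h0 : Summable fun n : ℕ => a n * Real.exp s ^ n := by
    simpa using hK.summable_pow_mul 0 hs 0
  have h1 : Summable fun n : ℕ => (n : ℝ) * a n * Real.exp s ^ n := by
    simpa [mul_assoc] using hK.summable_pow_mul 0 hs 1
  have h2 : Summable fun n : ℕ => (n : ℝ) ^ 2 * a n * Real.exp s ^ n := by
    simpa [mul_assoc] using hK.summable_pow_mul 0 hs 2
  have h : ∀ n : ℕ, a n * Real.exp s ^ n / fsum a (Real.exp s) *
      ((n : ℝ) - mf a (Real.exp s)) ^ 2 =
        (n : ℝ) ^ 2 * a n * Real.exp s ^ n / fsum a (Real.exp s) -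
        2 * mf a (Real.exp s) * ((n : ℝ) * a n * Real.exp s ^ n / fsum a (Real.exp s)) +
        mf a (Real.exp s) ^ 2 / fsum a (Real.exp s) * (a n * Real.exp s ^ n) :=
    fun n => by ring
  rw [centralMoment, tsum_congr h,
    ((h2.div_const _).sub ((h1.div_const _).mul_left _)).tsum_add (h0.mul_left _),
    (h2.div_const _).tsum_sub ((h1.div_const _).mul_left _), tsum_mul_left, tsum_mul_left,
    tsum_div_const, tsum_div_const, sigma2]
  change _ - 2 * mf a (Real.exp s) * mf a (Real.exp s) + _ * fsum a (Real.exp s) = _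
  field_simp
  ring

lemma IsK.sigma2_pos (hK : IsK a R) (hs : s < Real.log R) : 0 < sigma2 a (Real.exp s) := by
  have hf := hK.fsum_pos (Real.exp_pos s).le ((Real.lt_log_iff_exp_lt hK.Rpos).1 hs)
  have hsum : Summable fun n : ℕ => a n * Real.exp s ^ n / fsum a (Real.exp s) *
      ((n : ℝ) - mf a (Real.exp s)) ^ 2 :=
    ((hK.summable_pow_mul (mf a (Real.exp s)) hs 2).div_const (fsum a (Real.exp s))).congr
      fun n => by ring
  have hnn : ∀ n : ℕ, 0 ≤ a n * Real.exp s ^ n / fsum a (Real.exp s) *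
      ((n : ℝ) - mf a (Real.exp s)) ^ 2 := fun n => by
    have := hK.nonneg n
    positivity
  rw [← hK.centralMoment_two hs, centralMoment]
  obtain ⟨N, hN, haN⟩ := hK.nonconst
  by_cases hm : mf a (Real.exp s) = 0
  · refine hsum.tsum_pos hnn N ?_
    rw [hm, sub_zero]
    positivity
  · refine hsum.tsum_pos hnn 0 ?_
    have := hK.pos₀
    have : (0 : ℝ) < (((0 : ℕ) : ℝ) - mf a (Real.exp s)) ^ 2 := by
      simpa using (sq_pos_of_ne_zero hm)
    positivity

/-- Centring only changes the first derivative of the fulcrum. -/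
lemma IsK.iteratedDeriv_log_mgf_coeffMeasure (hK : IsK a R) (m : ℝ) (hs : s < Real.log R)
    (j : ℕ) :
    iteratedDeriv (j + 2)
        (fun u => Real.log (mgf (fun n : ℕ => (n : ℝ) - m) (coeffMeasure a) u)) s =
      iteratedDeriv (j + 2) (fulcrum a) s := by
  have hev : (fun u => Real.log (mgf (fun n : ℕ => (n : ℝ) - m) (coeffMeasure a) u)) =ᶠ[𝓝 s]
      fun u => fulcrum a u - u * m := by
    filter_upwards [Iio_mem_nhds hs] with u hu
    have hf := hK.fsum_pos (Real.exp_pos u).le ((Real.lt_log_iff_exp_lt hK.Rpos).1 hu)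
    rw [mgf_coeffMeasure hK.nonneg, Real.log_mul (Real.exp_pos _).ne' hf.ne', Real.log_exp,
      fulcrum]
    ring
  have hF : AnalyticAt ℝ (fulcrum a) s := by
    have h := (analyticAt_mgf (hK.mem_interior_integrableExpSet 0 hs)).log
      (by rw [mgf_coeffMeasure hK.nonneg]
          have := hK.fsum_pos (Real.exp_pos s).le ((Real.lt_log_iff_exp_lt hK.Rpos).1 hs)
          positivity)
    refine h.congr (Eventually.of_forall fun u => ?_)
    simp only [mgf_coeffMeasure hK.nonneg, fulcrum, mul_zero, neg_zero, Real.exp_zero, one_mul]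
  have hlin : iteratedDeriv (j + 2) (fun u : ℝ => u * m) s = 0 := by
    have h1 : deriv (fun u : ℝ => u * m) = fun _ => m := by
      ext u
      simp
    rw [iteratedDeriv_succ', h1, iteratedDeriv_const]
    simp
  rw [hev.iteratedDeriv_eq]
  have := iteratedDeriv_sub (n := j + 2) hF.contDiffAt
    (g := fun u : ℝ => u * m) (x := s) (by fun_prop)
  rw [hlin, sub_zero] at this
  exact this

/-- The moment-cumulant recursion for the centred Khinchin family. -/
lemma IsK.centralMoment_succ (hK : IsK a R) (hs : s < Real.log R) (n : ℕ) :
    centralMoment a (Real.exp s) (n + 1) = ∑ i ∈ Finset.range n,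
      (n.choose (i + 1) : ℝ) * iteratedDeriv (i + 2) (fulcrum a) s *
        centralMoment a (Real.exp s) (n - 1 - i) := by
  set G := mgf (fun n : ℕ => (n : ℝ) - mf a (Real.exp s)) (coeffMeasure a) with hGdef
  have hG : AnalyticAt ℝ G s := analyticAt_mgf (hK.mem_interior_integrableExpSet _ hs)
  have hf := hK.fsum_pos (Real.exp_pos s).le ((Real.lt_log_iff_exp_lt hK.Rpos).1 hs)
  have hGs : G s = Real.exp (-(s * mf a (Real.exp s))) * fsum a (Real.exp s) :=
    mgf_coeffMeasure hK.nonneg _ _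
  have hpos : 0 < G s := by rw [hGs]; positivity
  have hD : ∀ k, iteratedDeriv k G s = G s * centralMoment a (Real.exp s) k := fun k => by
    rw [hGs]; exact hK.iteratedDeriv_mgf_coeffMeasure hs k
  have hL1 : iteratedDeriv 1 (fun u => Real.log (G u)) s = 0 := by
    have := hD 1
    rw [hK.centralMoment_one hs, mul_zero, iteratedDeriv_one] at this
    rw [iteratedDeriv_one, deriv.log hG.differentiableAt hpos.ne', this, zero_div]
  have h := iteratedDeriv_succ_eq_sum_log hG hpos n
  rw [Finset.sum_range_succ', zero_add, hL1, mul_zero, zero_mul, add_zero, hD] at h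
  refine mul_left_cancel₀ hpos.ne' ?_
  rw [h, Finset.mul_sum]
  refine Finset.sum_congr rfl fun i _ => ?_
  rw [hD, hK.iteratedDeriv_log_mgf_coeffMeasure _ hs, show n - (i + 1) = n - 1 - i by omega]
  ring

lemma IsK.iteratedDeriv_two_fulcrum (hK : IsK a R) (hs : s < Real.log R) :
    iteratedDeriv 2 (fulcrum a) s = sigma2 a (Real.exp s) := by
  have := hK.centralMoment_succ hs 1
  simpa [hK.centralMoment_two hs, hK.centralMoment_zero hs] using this.symm

lemma normMoment_eq_div (a : ℕ → ℝ) (t : ℝ) (k : ℕ) :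
    normMoment a t k = centralMoment a t k / sigma a t ^ k := by
  rw [normMoment, centralMoment, ← tsum_div_const]
  exact tsum_congr fun n => by rw [div_pow, mul_div_assoc']

lemma IsK.sigma_pos (hK : IsK a R) (hs : s < Real.log R) : 0 < sigma a (Real.exp s) :=
  Real.sqrt_pos.2 (hK.sigma2_pos hs)

lemma IsK.Fq_eq_div (hK : IsK a R) (hs : s < Real.log R) (j : ℕ) :
    Fq a j s = iteratedDeriv j (fulcrum a) s / sigma a (Real.exp s) ^ j := by
  rw [Fq, hK.iteratedDeriv_two_fulcrum hs, sigma, Real.sqrt_eq_rpow, ← Real.rpow_mul_natCast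
    (hK.sigma2_pos hs).le, one_div_mul_eq_div]

/-- The moment-cumulant recursion for the normalized Khinchin family. -/
lemma IsK.normMoment_succ (hK : IsK a R) (hs : s < Real.log R) (n : ℕ) :
    normMoment a (Real.exp s) (n + 1) = ∑ i ∈ Finset.range n,
      (n.choose (i + 1) : ℝ) * Fq a (i + 2) s * normMoment a (Real.exp s) (n - 1 - i) := by
  have hσ := (hK.sigma_pos hs).ne'
  rw [normMoment_eq_div, hK.centralMoment_succ hs, Finset.sum_div]
  refine Finset.sum_congr rfl fun i hi => ?_
  have hi := Finset.mem_range.1 hi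
  rw [normMoment_eq_div, hK.Fq_eq_div hs, show n + 1 = (i + 2) + (n - 1 - i) by omega, pow_add]
  field_simp

end Measure

lemma map_exp_nhdsLT_log {R : ℝ} (hR : 0 < R) : map Real.exp (𝓝[<] Real.log R) = 𝓝[<] R := by
  refine le_antisymm ?_ ?_
  · refine tendsto_nhdsWithin_iff.2 ⟨?_, ?_⟩
    · have := Real.continuous_exp.tendsto (Real.log R)
      rw [Real.exp_log hR] at this
      exact this.mono_left nhdsWithin_le_nhds
    · filter_upwards [self_mem_nhdsWithin] with s hs
      exact (Real.lt_log_iff_exp_lt hR).1 hs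
  · have hpos : ∀ᶠ t in 𝓝[<] R, 0 < t := nhdsWithin_le_nhds (lt_mem_nhds hR)
    have hlog : Tendsto Real.log (𝓝[<] R) (𝓝[<] Real.log R) := by
      refine tendsto_nhdsWithin_iff.2
        ⟨(Real.continuousAt_log hR.ne').tendsto.mono_left nhdsWithin_le_nhds, ?_⟩
      filter_upwards [self_mem_nhdsWithin, hpos] with t ht ht0
      exact Real.log_lt_log ht0 ht
    calc 𝓝[<] R = map (fun t => Real.exp (Real.log t)) (𝓝[<] R) := by
          exact (map_id.symm.trans
            (Filter.map_congr (hpos.mono fun t ht => (Real.exp_log ht).symm)))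
      _ = map Real.exp (map Real.log (𝓝[<] R)) := (map_map ..).symm
      _ ≤ map Real.exp (𝓝[<] Real.log R) := map_mono hlog

/-- `limsup_{s↑ln R} |F^{(j)}(s)|/F''(s)^{j/2} < ∞` for `3 ≤ j ≤ n` iff
`limsup_{t↑R} |E(X̆_t^k)| < ∞` for `3 ≤ k ≤ n`. -/
theorem statement7 (a : ℕ → ℝ) (R : ℝ) (hK : IsK a R) (n : ℕ) (hn : 3 ≤ n) :
    (∀ j : ℕ, 3 ≤ j → j ≤ n →
        IsBoundedUnder (· ≤ ·) (𝓝[<] Real.log R)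
          (fun s => |iteratedDeriv j (fulcrum a) s| /
            (iteratedDeriv 2 (fulcrum a) s) ^ ((j : ℝ) / 2))) ↔
    (∀ k : ℕ, 3 ≤ k → k ≤ n →
        IsBoundedUnder (· ≤ ·) (𝓝[<] R) (fun t => |normMoment a t k|)) := by
  have hlt : ∀ᶠ s in 𝓝[<] Real.log R, s < Real.log R := self_mem_nhdsWithin
  have hleft : ∀ j : ℕ, IsBoundedUnder (· ≤ ·) (𝓝[<] Real.log R)
      (fun s => |iteratedDeriv j (fulcrum a) s| /
        (iteratedDeriv 2 (fulcrum a) s) ^ ((j : ℝ) / 2)) ↔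
      Fq a j =O[𝓝[<] Real.log R] (1 : ℝ → ℝ) := fun j => by
    rw [Pi.one_def, isBigO_one_iff, IsBoundedUnder, IsBoundedUnder, Filter.map_congr]
    filter_upwards [hlt] with s hs
    have h2 : 0 ≤ iteratedDeriv 2 (fulcrum a) s := by
      rw [hK.iteratedDeriv_two_fulcrum hs]
      exact (hK.sigma2_pos hs).le
    rw [Fq, Real.norm_eq_abs, abs_div, abs_of_nonneg (Real.rpow_nonneg h2 _)]
  have hright : ∀ k : ℕ, IsBoundedUnder (· ≤ ·) (𝓝[<] R) (fun t => |normMoment a t k|) ↔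
      (fun s => normMoment a (Real.exp s) k) =O[𝓝[<] Real.log R] (1 : ℝ → ℝ) := fun k => by
    rw [← map_exp_nhdsLT_log hK.Rpos, isBoundedUnder_map_iff, Pi.one_def, isBigO_one_iff]
    rfl
  simp only [hleft, hright]
  have hM0 : (fun s => normMoment a (Real.exp s) 0) =ᶠ[𝓝[<] Real.log R] 1 := by
    filter_upwards [hlt] with s hs
    simp [normMoment_eq_div, hK.centralMoment_zero hs]
  have hM1 : (fun s => normMoment a (Real.exp s) 1) =ᶠ[𝓝[<] Real.log R] 0 := by
    filter_upwards [hlt] with s hs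
    simp [normMoment_eq_div, hK.centralMoment_one hs]
  have hκ2 : Fq a 2 =ᶠ[𝓝[<] Real.log R] 1 := by
    filter_upwards [hlt] with s hs
    simp [Fq, hK.iteratedDeriv_two_fulcrum hs, (hK.sigma2_pos hs).ne']
  exact isBigO_one_cumulant_iff_moment (M := fun k s => normMoment a (Real.exp s) k)
    hM0 (hM1.trans_isBigO (isBigO_zero _ _)) (hκ2.trans_isBigO (isBigO_refl _ _))
    (fun m => hlt.mono fun s hs => hK.normMoment_succ hs m) n

end KhinchinPaper
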